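/- arXiv:1102.0180 — 8 statements merged into one kernel-verified Lean document; each statement's English description precedes it below -/
import Mathlib

section
/- Let w : {1,…,N} → ℕ be a weight function with w(i) ≥ 1 for all i, and let f : ℝ^N → ℝ be a smooth (C^∞) function which is homogeneous of degree k ∈ ℕ with respect to the standard weighted action, i.e. f(δ_t(x)) = t^k · f(x) for all t > 0 and all x ∈ ℝ^N. Then f is a polynomial function: there exists a polynomial P in N variables with real coefficients such that f(x) = P(x) for all x, and every monomial of P with nonzero coefficient has weighted degree k (i.e. Σ_i w(i)·k_i = k for its exponent vector (k_1,…,k_N)). -/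
open Filter Topology

/-- The partial derivatives of a function homogeneous of degree `k` for a weighted action
satisfy the expected scaling relation. -/
theorem pow_mul_fderiv_single_of_weighted_homogeneous {N : ℕ} {w : Fin N → ℕ} {k : ℕ}
    {f : (Fin N → ℝ) → ℝ} (hf : Differentiable ℝ f)
    (hhom : ∀ t : ℝ, 0 < t → ∀ x : Fin N → ℝ, f (fun i => t ^ w i * x i) = t ^ k * f x)
    (i : Fin N) {t : ℝ} (ht : 0 < t) (x : Fin N → ℝ) :
    t ^ w i * fderiv ℝ f (fun j => t ^ w j * x j) (Pi.single i 1) =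
      t ^ k * fderiv ℝ f x (Pi.single i 1) := by
  let D : (Fin N → ℝ) →L[ℝ] (Fin N → ℝ) :=
    ContinuousLinearMap.pi fun j => t ^ w j • ContinuousLinearMap.proj j
  have hD (y : Fin N → ℝ) : D y = fun j => t ^ w j * y j := by
    ext j
    simp [D]
  have h₁ : HasFDerivAt (fun y => f (D y)) ((fderiv ℝ f (D x)).comp D) x :=
    (hf (D x)).hasFDerivAt.comp x D.hasFDerivAt
  have h₂ : HasFDerivAt (fun y => f (D y)) (t ^ k • fderiv ℝ f x) x := by
    have : (fun y => f (D y)) = fun y => t ^ k * f y := by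
      ext y
      rw [hD, hhom t ht]
    rw [this]
    exact (hf x).hasFDerivAt.const_mul _
  have h := DFunLike.congr_fun (h₁.unique h₂) (Pi.single i 1)
  have hs : D (Pi.single i 1) = t ^ w i • Pi.single i (1 : ℝ) := by
    ext j
    by_cases hj : j = i
    · subst hj
      simp [hD]
    · simp [hD, hj]
  simpa [hs, hD x] using h

/-- Euler's identity for a weighted action. -/
theorem sum_weight_mul_fderiv_of_weighted_homogeneous {N : ℕ} {w : Fin N → ℕ} {k : ℕ}
    {f : (Fin N → ℝ) → ℝ} (hf : Differentiable ℝ f)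
    (hhom : ∀ t : ℝ, 0 < t → ∀ x : Fin N → ℝ, f (fun i => t ^ w i * x i) = t ^ k * f x)
    (x : Fin N → ℝ) :
    ∑ i, w i * x i * fderiv ℝ f x (Pi.single i 1) = k * f x := by
  have hc : HasDerivAt (fun t : ℝ => fun i => t ^ w i * x i) (fun i => w i * x i) 1 := by
    rw [hasDerivAt_pi]
    intro i
    simpa using (hasDerivAt_pow (w i) (1 : ℝ)).mul_const (x i)
  have hx : (fun i => (1 : ℝ) ^ w i * x i) = x := by simp
  have h₁ : HasDerivAt (fun t : ℝ => f (fun i => t ^ w i * x i))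
      (fderiv ℝ f x (fun i => w i * x i)) 1 :=
    HasFDerivAt.comp_hasDerivAt_of_eq 1 (hf x).hasFDerivAt hc hx.symm
  have h₂ : HasDerivAt (fun t : ℝ => f (fun i => t ^ w i * x i)) (k * f x) 1 := by
    have h := (hasDerivAt_pow k (1 : ℝ)).mul_const (f x)
    simp only [one_pow, mul_one] at h
    refine h.congr_of_eventuallyEq ?_
    filter_upwards [lt_mem_nhds one_pos] with t ht using hhom t ht x
  rw [← h₁.unique h₂, ← LinearMap.sum_single_apply (fun _ => ℝ) (fun i => w i * x i), map_sum]
  refine Finset.sum_congr rfl fun i _ => ?_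
  have : (Pi.single i (w i * x i) : Fin N → ℝ) = (w i * x i) • Pi.single i (1 : ℝ) := by
    rw [← Pi.single_smul]
    simp
  simp [this]

/-- Under a weighted action with positive weights, points contract to the origin. -/
theorem tendsto_weighted_action_zero {N : ℕ} {w : Fin N → ℕ} (hw : ∀ i, 1 ≤ w i)
    (x : Fin N → ℝ) :
    Tendsto (fun t : ℝ => fun i => t ^ w i * x i) (𝓝[>] 0) (𝓝 0) := by
  have h : Continuous fun t : ℝ => fun i => t ^ w i * x i := by fun_prop
  have h₀ : (fun i => (0 : ℝ) ^ w i * x i) = 0 := by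
    ext i
    simp [zero_pow (Nat.one_le_iff_ne_zero.mp (hw i))]
  simpa only [h₀] using (h.tendsto 0).mono_left nhdsWithin_le_nhds

/-- A continuous function satisfying a homogeneity relation of negative degree vanishes. -/
theorem eq_zero_of_weighted_homogeneous_neg {N : ℕ} {w : Fin N → ℕ} (hw : ∀ i, 1 ≤ w i)
    {g : (Fin N → ℝ) → ℝ} (hg : Continuous g) {a k : ℕ} (hka : k < a)
    (h : ∀ t : ℝ, 0 < t → ∀ x : Fin N → ℝ, t ^ a * g (fun i => t ^ w i * x i) = t ^ k * g x)
    (x : Fin N → ℝ) : g x = 0 := by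
  have hlim : Tendsto (fun t : ℝ => t ^ (a - k) * g (fun i => t ^ w i * x i))
      (𝓝[>] 0) (𝓝 (0 ^ (a - k) * g 0)) :=
    (((continuous_pow (a - k)).tendsto 0).mono_left nhdsWithin_le_nhds).mul
      ((hg.tendsto 0).comp (tendsto_weighted_action_zero hw x))
  rw [zero_pow (Nat.sub_ne_zero_of_lt hka), zero_mul] at hlim
  refine tendsto_nhds_unique (tendsto_const_nhds.congr' ?_) hlim
  filter_upwards [self_mem_nhdsWithin] with t ht
  have ht : 0 < t := ht
  apply mul_left_cancel₀ (pow_pos ht k).ne'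
  rw [← h t ht x, ← mul_assoc, ← pow_add, Nat.add_sub_cancel' hka.le]

/-- A smooth function homogeneous for a positively weighted action is a weighted homogeneous
polynomial. -/
theorem exists_isWeightedHomogeneous_eval_eq {N : ℕ} {w : Fin N → ℕ} (hw : ∀ i, 1 ≤ w i) (k : ℕ)
    (f : (Fin N → ℝ) → ℝ) (hf : ContDiff ℝ (⊤ : ℕ∞) f)
    (hhom : ∀ t : ℝ, 0 < t → ∀ x : Fin N → ℝ, f (fun i => t ^ w i * x i) = t ^ k * f x) :
    ∃ P : MvPolynomial (Fin N) ℝ, P.IsWeightedHomogeneous w k ∧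
      ∀ x, f x = MvPolynomial.eval x P := by
  induction k using Nat.strong_induction_on generalizing f with
  | _ k ih =>
  rcases Nat.eq_zero_or_pos k with rfl | hk
  · refine ⟨MvPolynomial.C (f 0), MvPolynomial.isWeightedHomogeneous_C w _, fun x => ?_⟩
    rw [MvPolynomial.eval_C]
    refine tendsto_nhds_unique (tendsto_const_nhds.congr' ?_)
      ((hf.continuous.tendsto 0).comp (tendsto_weighted_action_zero hw x))
    filter_upwards [self_mem_nhdsWithin] with t ht
    simpa using (hhom t ht x).symm
  have hd : Differentiable ℝ f := hf.differentiable (by simp)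
  have hpd (i : Fin N) : ContDiff ℝ (⊤ : ℕ∞) fun x => fderiv ℝ f x (Pi.single i 1) :=
    (hf.fderiv_right (m := (⊤ : ℕ∞)) (by simp)).clm_apply contDiff_const
  have hscale (i : Fin N) (t : ℝ) (ht : 0 < t) (x : Fin N → ℝ) :=
    pow_mul_fderiv_single_of_weighted_homogeneous hd hhom i ht x
  have hQ (i : Fin N) : ∃ Q : MvPolynomial (Fin N) ℝ,
      (MvPolynomial.X i * Q).IsWeightedHomogeneous w k ∧
        ∀ x, fderiv ℝ f x (Pi.single i 1) = MvPolynomial.eval x Q := by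
    rcases lt_or_ge k (w i) with hki | hik
    · refine ⟨0, ?_, fun x => ?_⟩
      · simpa using MvPolynomial.isWeightedHomogeneous_zero ℝ w k
      · simpa using eq_zero_of_weighted_homogeneous_neg hw (hpd i).continuous hki (hscale i) x
    · obtain ⟨Q, hQ, hQe⟩ := ih (k - w i) (Nat.sub_lt hk (hw i)) _ (hpd i) fun t ht x => by
        apply mul_left_cancel₀ (pow_pos ht (w i)).ne'
        rw [hscale i t ht x, ← mul_assoc, ← pow_add, Nat.add_sub_cancel' hik]
      refine ⟨Q, ?_, hQe⟩
      have h := (MvPolynomial.isWeightedHomogeneous_X ℝ w i).mul hQ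
      rwa [Nat.add_sub_cancel' hik] at h
  choose Q hQ hQe using hQ
  refine ⟨∑ i, MvPolynomial.C ((k : ℝ)⁻¹ * w i) * (MvPolynomial.X i * Q i), ?_, fun x => ?_⟩
  · refine MvPolynomial.IsWeightedHomogeneous.sum _ _ _ fun i _ => ?_
    simpa using (MvPolynomial.isWeightedHomogeneous_C w ((k : ℝ)⁻¹ * w i)).mul (hQ i)
  · have hk' : (k : ℝ) ≠ 0 := Nat.cast_ne_zero.mpr hk.ne'
    apply mul_left_cancel₀ hk'
    rw [← sum_weight_mul_fderiv_of_weighted_homogeneous hd hhom x, map_sum, Finset.mul_sum]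
    refine Finset.sum_congr rfl fun i _ => ?_
    simp only [map_mul, MvPolynomial.eval_C, MvPolynomial.eval_X, hQe]
    field_simp

/-- Any smooth function on ℝ^N that is homogeneous of degree `k` with respect to the
standard weighted action with positive weights is a polynomial whose monomials all have
weighted degree `k`. -/
theorem stmt_0 (N : ℕ) (w : Fin N → ℕ) (hw : ∀ i, 1 ≤ w i) (k : ℕ)
    (f : (Fin N → ℝ) → ℝ) (hf : ContDiff ℝ (⊤ : ℕ∞) f)
    (hhom : ∀ t : ℝ, 0 < t → ∀ x : Fin N → ℝ,
      f (fun i => t ^ w i * x i) = t ^ k * f x) :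
    ∃ P : MvPolynomial (Fin N) ℝ,
      (∀ x : Fin N → ℝ, f x = MvPolynomial.eval x P) ∧
      (∀ m ∈ P.support, ∑ i, w i * m i = k) := by
  obtain ⟨P, hP, hPe⟩ := exists_isWeightedHomogeneous_eval_eq hw k f hf hhom
  refine ⟨P, hPe, fun m hm => ?_⟩
  rw [← hP (MvPolynomial.mem_support_iff.mp hm), Finsupp.weight_apply,
    Finsupp.sum_fintype _ _ (by simp)]
  simp [mul_comm]
end

section
/- Let w : {1,…,N} → ℕ be a weight function with w(i) ≥ 1 for all i, and let ψ : ℝ^N → ℝ^N be a bijection such that both ψ and ψ^{-1} are smooth (C^∞) and ψ ∘ δ_t = δ_t ∘ ψ for all t ≥ 0. Then each component ψ_i of ψ is a polynomial function in x_1,…,x_N, and every monomial of ψ_i with nonzero coefficient has weighted degree equal to w(i), i.e. ψ_i(x) = Σ_{⟨w|k⟩ = w(i)} α^i_k · x_1^{k_1}⋯x_N^{k_N} where ⟨w|k⟩ = Σ_j w(j)·k_j. -/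
open Filter Topology in
/-- Along each orbit of a weighted action with positive weights, a continuous function tends to
its value at the origin as the dilation parameter tends to zero. -/
theorem tendsto_comp_weighted_dilation {ι : Type*} {w : ι → ℕ} (hw : ∀ i, 1 ≤ w i)
    {f : (ι → ℝ) → ℝ} (hf : Continuous f) (x : ι → ℝ) :
    Tendsto (fun t : ℝ => f (fun i => t ^ w i * x i)) (𝓝[>] 0) (𝓝 (f 0)) := by
  have h : Continuous (fun t : ℝ => f (fun i => t ^ w i * x i)) := by fun_prop
  have h0 := (h.tendsto 0).mono_left (nhdsWithin_le_nhds (s := Set.Ioi (0 : ℝ)))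
  have e : (fun i => (0 : ℝ) ^ w i * x i) = 0 := by
    funext i
    simp [zero_pow (Nat.one_le_iff_ne_zero.mp (hw i))]
  simpa only [e] using h0

/-- The partial derivatives of a weighted homogeneous function are weighted homogeneous. -/
theorem fderiv_weighted_dilation {ι : Type*} [Fintype ι] [DecidableEq ι] {w : ι → ℕ} {d : ℕ}
    {f : (ι → ℝ) → ℝ} (hf : Differentiable ℝ f) {t : ℝ}
    (h : ∀ x : ι → ℝ, f (fun i => t ^ w i * x i) = t ^ d * f x) (x : ι → ℝ) (j : ι) :
    t ^ w j * fderiv ℝ f (fun i => t ^ w i * x i) (Pi.single j 1) =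
      t ^ d * fderiv ℝ f x (Pi.single j 1) := by
  let D : (ι → ℝ) →L[ℝ] (ι → ℝ) :=
    ContinuousLinearMap.pi fun i => t ^ w i • ContinuousLinearMap.proj i
  have h1 : HasFDerivAt (fun y => f (D y)) ((fderiv ℝ f (D x)).comp D) x :=
    (hf (D x)).hasFDerivAt.comp x D.hasFDerivAt
  have h2 : HasFDerivAt (fun y => f (D y)) (t ^ d • fderiv ℝ f x) x := by
    have e : (fun y => f (D y)) = fun y => t ^ d • f y := funext h
    rw [e]
    exact (hf x).hasFDerivAt.const_smul (t ^ d)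
  have h3 := congrArg (fun L : (ι → ℝ) →L[ℝ] ℝ => L (Pi.single j 1)) (h1.unique h2)
  have e : D (Pi.single j 1) = t ^ w j • Pi.single j 1 := by
    funext i
    by_cases hij : i = j
    · subst hij; simp [D]
    · simp [D, hij]
  have h4 : t ^ w j * fderiv ℝ f (D x) (Pi.single j 1) = t ^ d * fderiv ℝ f x (Pi.single j 1) := by
    simpa [e] using h3
  exact h4

/-- Euler's identity for weighted homogeneous functions. -/
theorem sum_weight_mul_fderiv {ι : Type*} [Fintype ι] [DecidableEq ι] {w : ι → ℕ} {d : ℕ}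
    {f : (ι → ℝ) → ℝ} (hf : Differentiable ℝ f)
    (h : ∀ t : ℝ, 0 < t → ∀ x : ι → ℝ, f (fun i => t ^ w i * x i) = t ^ d * f x) (x : ι → ℝ) :
    ∑ j, w j * x j * fderiv ℝ f x (Pi.single j 1) = d * f x := by
  have hγ : HasDerivAt (fun t : ℝ => fun i => t ^ w i * x i) (fun i => w i * x i) 1 := by
    rw [hasDerivAt_pi]
    intro i
    simpa using (hasDerivAt_pow (w i) (1 : ℝ)).mul_const (x i)
  have hx : (fun i => (1 : ℝ) ^ w i * x i) = x := by simp
  have h1 : HasDerivAt (fun t : ℝ => f (fun i => t ^ w i * x i))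
      (fderiv ℝ f x (fun i => w i * x i)) 1 := by
    have hfx : HasFDerivAt f (fderiv ℝ f x) (fun i => (1 : ℝ) ^ w i * x i) := by
      rw [hx]
      exact (hf x).hasFDerivAt
    exact hfx.comp_hasDerivAt 1 hγ
  have h2 : HasDerivAt (fun t : ℝ => f (fun i => t ^ w i * x i)) (d * f x) 1 := by
    have h3 : HasDerivAt (fun t : ℝ => t ^ d * f x) (d * f x) 1 := by
      simpa using (hasDerivAt_pow d (1 : ℝ)).mul_const (f x)
    refine h3.congr_of_eventuallyEq ?_
    filter_upwards [lt_mem_nhds (zero_lt_one (α := ℝ))] with t ht using h t ht x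
  rw [← h1.unique h2]
  have := LinearMap.pi_apply_eq_sum_univ (fderiv ℝ f x).toLinearMap (fun i => w i * x i)
  simp only [ContinuousLinearMap.coe_coe, smul_eq_mul] at this
  rw [this]
  refine Finset.sum_congr rfl fun j _ => ?_
  congr 2
  funext i
  simp [Pi.single_apply, eq_comm]

open Filter Topology in
/-- A smooth function that is homogeneous for a weighted action with positive weights is a
weighted homogeneous polynomial. -/
theorem exists_isWeightedHomogeneous_of_contDiff {ι : Type*} [Fintype ι] {w : ι → ℕ}
    (hw : ∀ i, 1 ≤ w i) (d : ℕ) {f : (ι → ℝ) → ℝ} (hf : ContDiff ℝ (⊤ : ℕ∞) f)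
    (h : ∀ t : ℝ, 0 < t → ∀ x : ι → ℝ, f (fun i => t ^ w i * x i) = t ^ d * f x) :
    ∃ P : MvPolynomial ι ℝ, (∀ x, f x = MvPolynomial.eval x P) ∧
      MvPolynomial.IsWeightedHomogeneous w P d := by
  classical
  induction d using Nat.strong_induction_on generalizing f with
  | _ d ih =>
    rcases Nat.eq_zero_or_pos d with rfl | hd
    · refine ⟨MvPolynomial.C (f 0), fun x => ?_, MvPolynomial.isWeightedHomogeneous_C w _⟩
      rw [MvPolynomial.eval_C]
      refine tendsto_nhds_unique ?_ (tendsto_comp_weighted_dilation hw hf.continuous x)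
      refine tendsto_const_nhds.congr' ?_
      filter_upwards [self_mem_nhdsWithin] with t ht
      rw [h t ht, pow_zero, one_mul]
    have hdiff : Differentiable ℝ f := hf.differentiable (by simp)
    have hsmooth (j : ι) : ContDiff ℝ (⊤ : ℕ∞) fun x => fderiv ℝ f x (Pi.single j 1) :=
      (hf.fderiv_right (m := (⊤ : ℕ∞)) (by simp)).clm_apply contDiff_const
    have key (j : ι) : ∃ Q : MvPolynomial ι ℝ,
        (∀ x, fderiv ℝ f x (Pi.single j 1) = MvPolynomial.eval x Q) ∧
          MvPolynomial.IsWeightedHomogeneous w (MvPolynomial.X j * Q) d := by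
      by_cases hj : w j ≤ d
      · obtain ⟨Q, hQ, hQw⟩ := ih (d - w j) (Nat.sub_lt hd (hw j)) (hsmooth j) (by
          intro t ht x
          refine mul_left_cancel₀ (pow_ne_zero (w j) ht.ne') ?_
          rw [fderiv_weighted_dilation hdiff (h t ht), ← mul_assoc, ← pow_add,
            Nat.add_sub_cancel' hj])
        refine ⟨Q, hQ, ?_⟩
        simpa [Nat.add_sub_cancel' hj] using
          (MvPolynomial.isWeightedHomogeneous_X ℝ w j).mul hQw
      · refine ⟨0, fun x => ?_, ?_⟩
        · rw [map_zero]
          have hlim := (((continuous_pow (w j - d)).tendsto (0 : ℝ)).mono_left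
            (nhdsWithin_le_nhds (s := Set.Ioi (0 : ℝ)))).mul
            (tendsto_comp_weighted_dilation hw (hsmooth j).continuous x)
          rw [zero_pow (by omega), zero_mul] at hlim
          refine tendsto_nhds_unique (tendsto_const_nhds.congr' ?_) hlim
          filter_upwards [self_mem_nhdsWithin] with t (ht : 0 < t)
          refine mul_left_cancel₀ (pow_ne_zero d ht.ne') ?_
          rw [← fderiv_weighted_dilation hdiff (h t ht), ← mul_assoc, ← pow_add,
            Nat.add_sub_cancel' (by omega)]
        · rw [mul_zero]
          exact MvPolynomial.isWeightedHomogeneous_zero ℝ w d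
    choose Q hQ hQw using key
    refine ⟨∑ j, MvPolynomial.C ((w j : ℝ) / d) * (MvPolynomial.X j * Q j), fun x => ?_,
      MvPolynomial.IsWeightedHomogeneous.sum _ _ _ fun j _ => (hQw j).C_mul _⟩
    have hd' : (d : ℝ) ≠ 0 := by exact_mod_cast hd.ne'
    refine mul_left_cancel₀ hd' ?_
    rw [← sum_weight_mul_fderiv hdiff h x, map_sum, Finset.mul_sum]
    refine Finset.sum_congr rfl fun j _ => ?_
    rw [hQ]
    simp only [map_mul, MvPolynomial.eval_C, MvPolynomial.eval_X]
    field_simp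

/-- Any automorphism of the standard graded space (a diffeomorphism of ℝ^N commuting with
the standard weighted action, all weights ≥ 1) is polynomial, with components whose monomials
have weighted degree equal to the weight of the corresponding coordinate. -/
theorem stmt_2 (N : ℕ) (w : Fin N → ℕ) (hw : ∀ i, 1 ≤ w i)
    (ψ φ : (Fin N → ℝ) → (Fin N → ℝ))
    (hψ : ContDiff ℝ (⊤ : ℕ∞) ψ) (hφ : ContDiff ℝ (⊤ : ℕ∞) φ)
    (hinv₁ : ∀ x, φ (ψ x) = x) (hinv₂ : ∀ x, ψ (φ x) = x)
    (heq : ∀ t : ℝ, 0 ≤ t → ∀ x : Fin N → ℝ,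
      ψ (fun i => t ^ w i * x i) = fun i => t ^ w i * ψ x i) :
    ∀ i : Fin N, ∃ P : MvPolynomial (Fin N) ℝ,
      (∀ x : Fin N → ℝ, ψ x i = MvPolynomial.eval x P) ∧
      (∀ m ∈ P.support, ∑ j, w j * m j = w i) := by
  intro i
  obtain ⟨P, hP, hPw⟩ := exists_isWeightedHomogeneous_of_contDiff hw (w i)
    (contDiff_pi.mp hψ i) fun t ht x => congrFun (heq t ht.le x) i
  refine ⟨P, hP, fun m hm => ?_⟩
  rw [← hPw (MvPolynomial.mem_support_iff.mp hm), Finsupp.weight_apply,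
    Finsupp.sum_fintype _ _ (by simp)]
  exact Finset.sum_congr rfl fun j _ => by rw [smul_eq_mul, mul_comm]
end

section
/- Let d₁, d₂ ≥ 1 and let ψ : ℝ^{d₁} × ℝ^{d₂} → ℝ^{d₁} × ℝ^{d₂} be a bijection such that both ψ and ψ^{-1} are smooth (C^∞) and ψ(t·x, t²·y) = (t·ψ₁(x,y), t²·ψ₂(x,y)) for all t ≥ 0 and all (x,y), where ψ = (ψ₁, ψ₂). Then there exist a linear isomorphism A : ℝ^{d₁} → ℝ^{d₁}, a linear isomorphism B : ℝ^{d₂} → ℝ^{d₂}, and a symmetric bilinear map C : ℝ^{d₁} × ℝ^{d₁} → ℝ^{d₂} such that ψ(x, y) = (A x, B y + C(x, x)) for all (x,y). -/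
section WeightedHomogeneous

variable {E F G : Type*} [NormedAddCommGroup E] [NormedSpace ℝ E] [NormedAddCommGroup F]
  [NormedSpace ℝ F] [NormedAddCommGroup G] [NormedSpace ℝ G]

/-- The velocity of an orbit of the action with weights `1` and `2`. -/
lemma hasDerivAt_weighted_orbit (x : E) (y : F) (t : ℝ) :
    HasDerivAt (fun s : ℝ => (s • x, s ^ 2 • y)) (x, (2 * t) • y) t := by
  have h₁ : HasDerivAt (fun s : ℝ => s • x) x t := by
    simpa using (hasDerivAt_id t).smul_const x
  have h₂ : HasDerivAt (fun s : ℝ => s ^ 2 • y) ((2 * t) • y) t := by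
    simpa using (hasDerivAt_pow 2 t).smul_const y
  exact h₁.prodMk h₂

/-- Two functions which agree on `[0, ∞)` have the same derivatives there. -/
lemma HasDerivAt.unique_of_eqOn_Ici {f g : ℝ → G} {f' g' : G} {t : ℝ} (ht : 0 ≤ t)
    (hf : HasDerivAt f f' t) (hg : HasDerivAt g g' t) (h : Set.EqOn f g (Set.Ici 0)) :
    f' = g' :=
  (uniqueDiffOn_Ici (0 : ℝ) t ht).eq_deriv _ hf.hasDerivWithinAt
    (hg.hasDerivWithinAt.congr h (h ht))

/-- A function of weight `1` that is differentiable at the origin is linear in the variable of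
weight `1`. -/
lemma eq_fderiv_of_weight_one {f : E × F → G} (hf : DifferentiableAt ℝ f 0)
    (h : ∀ t : ℝ, 0 ≤ t → ∀ x y, f (t • x, t ^ 2 • y) = t • f (x, y)) (x : E) (y : F) :
    f (x, y) = fderiv ℝ f 0 (x, 0) := by
  have h₁ : HasDerivAt (fun t : ℝ => f (t • x, t ^ 2 • y)) (fderiv ℝ f 0 (x, 0)) 0 := by
    have hγ := hasDerivAt_weighted_orbit x y 0
    rw [mul_zero, zero_smul] at hγ
    exact HasFDerivAt.comp_hasDerivAt_of_eq 0 hf.hasFDerivAt hγ (by simp [← Prod.mk_zero_zero])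
  have h₂ : HasDerivAt (fun t : ℝ => t • f (x, y)) (f (x, y)) 0 := by
    simpa using (hasDerivAt_id (0 : ℝ)).smul_const (f (x, y))
  exact (h₁.unique_of_eqOn_Ici le_rfl h₂ fun t ht => h t ht x y).symm

/-- A `C^2` function of weight `2` is the sum of a linear function of the variable of weight `2`
and a quadratic function of the variable of weight `1`. -/
lemma eq_fderiv_of_weight_two {g : E × F → G} (hg : ContDiff ℝ 2 g)
    (h : ∀ t : ℝ, 0 ≤ t → ∀ x y, g (t • x, t ^ 2 • y) = t ^ 2 • g (x, y)) (x : E) (y : F) :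
    g (x, y) = fderiv ℝ g 0 (0, y) + (1 / 2 : ℝ) • fderiv ℝ (fderiv ℝ g) 0 (x, 0) (x, 0) := by
  have hd : Differentiable ℝ g := hg.differentiable (by norm_num)
  have hd₂ : Differentiable ℝ (fderiv ℝ g) :=
    (hg.fderiv_right (m := 1) (by norm_num)).differentiable (by norm_num)
  have first (t : ℝ) (ht : 0 ≤ t) :
      fderiv ℝ g (t • x, t ^ 2 • y) (x, (2 * t) • y) = (2 * t) • g (x, y) := by
    have h₁ := (hd (t • x, t ^ 2 • y)).hasFDerivAt.comp_hasDerivAt t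
      (hasDerivAt_weighted_orbit x y t)
    have h₂ : HasDerivAt (fun s : ℝ => s ^ 2 • g (x, y)) ((2 * t) • g (x, y)) t := by
      simpa using (hasDerivAt_pow 2 t).smul_const (g (x, y))
    exact h₁.unique_of_eqOn_Ici ht h₂ fun s hs => h s hs x y
  have hlin : HasDerivAt (fun t : ℝ => 2 * t) 2 0 := by
    simpa using (hasDerivAt_id (0 : ℝ)).const_mul 2
  have hc : HasDerivAt (fun t : ℝ => fderiv ℝ g (t • x, t ^ 2 • y))
      (fderiv ℝ (fderiv ℝ g) 0 (x, 0)) 0 := by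
    have hγ := hasDerivAt_weighted_orbit x y 0
    rw [mul_zero, zero_smul] at hγ
    exact HasFDerivAt.comp_hasDerivAt_of_eq 0 (hd₂ 0).hasFDerivAt hγ (by simp [← Prod.mk_zero_zero])
  have hu : HasDerivAt (fun t : ℝ => (x, (2 * t) • y)) ((0 : E), (2 : ℝ) • y) 0 :=
    (hasDerivAt_const 0 x).prodMk (hlin.smul_const y)
  have key := (hc.clm_apply hu).unique_of_eqOn_Ici le_rfl (hlin.smul_const (g (x, y))) first
  have hy : ((0 : E), (2 : ℝ) • y) = (2 : ℝ) • ((0 : E), y) := by simp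
  simp only [mul_zero, zero_smul, ne_eq, OfNat.ofNat_ne_zero, not_false_eq_true, zero_pow,
    Prod.mk_zero_zero, hy, map_smul] at key
  calc g (x, y) = (1 / 2 : ℝ) • (2 : ℝ) • g (x, y) := by rw [smul_smul]; norm_num
    _ = _ := by rw [← key, smul_add, smul_smul, add_comm]; norm_num

end WeightedHomogeneous


/-- Any automorphism of the graded space ℝ^{d₁} × ℝ^{d₂} with weights (1,2) has the form
(x, y) ↦ (A x, B y + C(x,x)) with A, B linear isomorphisms and C symmetric bilinear. -/
theorem stmt_3 (d₁ d₂ : ℕ) (hd₁ : 1 ≤ d₁) (hd₂ : 1 ≤ d₂)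
    (ψ φ : (Fin d₁ → ℝ) × (Fin d₂ → ℝ) → (Fin d₁ → ℝ) × (Fin d₂ → ℝ))
    (hψ : ContDiff ℝ (⊤ : ℕ∞) ψ) (hφ : ContDiff ℝ (⊤ : ℕ∞) φ)
    (hinv₁ : ∀ p, φ (ψ p) = p) (hinv₂ : ∀ p, ψ (φ p) = p)
    (heq : ∀ t : ℝ, 0 ≤ t → ∀ p : (Fin d₁ → ℝ) × (Fin d₂ → ℝ),
      ψ (t • p.1, t ^ 2 • p.2) = (t • (ψ p).1, t ^ 2 • (ψ p).2)) :
    ∃ (A : (Fin d₁ → ℝ) ≃ₗ[ℝ] (Fin d₁ → ℝ)) (B : (Fin d₂ → ℝ) ≃ₗ[ℝ] (Fin d₂ → ℝ))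
      (C : (Fin d₁ → ℝ) →ₗ[ℝ] (Fin d₁ → ℝ) →ₗ[ℝ] (Fin d₂ → ℝ)),
      (∀ u v : Fin d₁ → ℝ, C u v = C v u) ∧
      (∀ (x : Fin d₁ → ℝ) (y : Fin d₂ → ℝ), ψ (x, y) = (A x, B y + C x x)) := by
  have hf : ContDiff ℝ (⊤ : ℕ∞) fun p => (ψ p).1 := contDiff_fst.comp hψ
  have hg : ContDiff ℝ 2 fun p => (ψ p).2 :=
    (contDiff_snd.comp hψ).of_le (WithTop.coe_le_coe.2 le_top)
  set f := fun p => (ψ p).1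
  set g := fun p => (ψ p).2
  let A := (fderiv ℝ f 0).toLinearMap ∘ₗ LinearMap.inl ℝ (Fin d₁ → ℝ) (Fin d₂ → ℝ)
  let B := (fderiv ℝ g 0).toLinearMap ∘ₗ LinearMap.inr ℝ (Fin d₁ → ℝ) (Fin d₂ → ℝ)
  let C : (Fin d₁ → ℝ) →ₗ[ℝ] (Fin d₁ → ℝ) →ₗ[ℝ] (Fin d₂ → ℝ) :=
    LinearMap.mk₂ ℝ (fun u v => (1 / 2 : ℝ) • fderiv ℝ (fderiv ℝ g) 0 (u, 0) (v, 0))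
      (fun u u' v => by
        rw [← smul_add, ← add_apply, ← map_add, Prod.mk_add_mk, add_zero])
      (fun c u v => by
        rw [show (c • u, (0 : Fin d₂ → ℝ)) = c • (u, 0) by simp, map_smul, smul_apply, smul_comm])
      (fun u v v' => by rw [← smul_add, ← map_add, Prod.mk_add_mk, add_zero])
      (fun c u v => by
        rw [show (c • v, (0 : Fin d₂ → ℝ)) = c • (v, 0) by simp, map_smul, smul_comm])
  have form (x : Fin d₁ → ℝ) (y : Fin d₂ → ℝ) : ψ (x, y) = (A x, B y + C x x) :=
    Prod.ext
      (eq_fderiv_of_weight_one (hf.differentiable (by simp) 0)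
        (fun t ht x y => congrArg Prod.fst (heq t ht (x, y))) x y)
      (eq_fderiv_of_weight_two hg
        (fun t ht x y => congrArg Prod.snd (heq t ht (x, y))) x y)
  have hA : Function.Surjective A := fun u =>
    ⟨(φ (u, 0)).1, (congrArg Prod.fst (form _ _)).symm.trans (congrArg Prod.fst (hinv₂ (u, 0)))⟩
  have hB : Function.Injective B := fun y y' h => by
    have : ψ (0, y) = ψ (0, y') := by rw [form, form, h]
    exact congrArg Prod.snd (Function.LeftInverse.injective hinv₁ this)
  refine ⟨LinearEquiv.ofBijective A ⟨LinearMap.injective_iff_surjective.2 hA, hA⟩,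
    LinearEquiv.ofBijective B ⟨hB, LinearMap.injective_iff_surjective.1 hB⟩, C, fun u v => ?_, form⟩
  have hsymm : IsSymmSndFDerivAt ℝ g 0 := hg.contDiffAt.isSymmSndFDerivAt (by simp)
  exact congrArg ((1 / 2 : ℝ) • ·) (hsymm.eq (u, 0) (v, 0))
end

section
/- Let w : {1,…,N₁} → ℕ and v : {1,…,N₂} → ℕ be weight functions with all values ≥ 1, let δ¹_t and δ²_t denote the corresponding standard weighted actions on ℝ^{N₁} and ℝ^{N₂}, and let Δ¹(x) = (w(1)x_1,…,w(N₁)x_{N₁}) and Δ²(y) = (v(1)y_1,…,v(N₂)y_{N₂}) be the associated weight vector fields. For a smooth (C^∞) map ψ : ℝ^{N₁} → ℝ^{N₂} the following are equivalent: (a) ψ ∘ δ¹_t = δ²_t ∘ ψ for all t ≥ 0; (b) for every r ∈ ℕ and every smooth function f : ℝ^{N₂} → ℝ that is homogeneous of degree r (f ∘ δ²_t = t^r f for all t > 0), the function f ∘ ψ is homogeneous of degree r (f ∘ ψ ∘ δ¹_t = t^r (f ∘ ψ) for all t > 0); (c) ψ relates the weight vector fields: Dψ(x)(Δ¹(x))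 = Δ²(ψ(x)) for all x ∈ ℝ^{N₁}, where Dψ(x) is the (Fréchet) derivative of ψ at x. -/
theorem hasDerivAt_weighted_action {ι : Type*} [Fintype ι] (w : ι → ℕ) (x : ι → ℝ) (t : ℝ) :
    HasDerivAt (fun s : ℝ => fun i => s ^ w i * x i)
      (fun i => (w i : ℝ) * t ^ (w i - 1) * x i) t :=
  hasDerivAt_pi.2 fun i => (hasDerivAt_pow (w i) t).mul_const (x i)

theorem smul_deriv_weighted_action {ι : Type*} {w : ι → ℕ} (hw : ∀ i, 1 ≤ w i)
    (x : ι → ℝ) (t : ℝ) :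
    t • (fun i => (w i : ℝ) * t ^ (w i - 1) * x i) = fun i => (w i : ℝ) * (t ^ w i * x i) := by
  ext i
  obtain ⟨k, hk⟩ := Nat.exists_eq_add_of_le' (hw i)
  simp only [Pi.smul_apply, smul_eq_mul, hk, Nat.add_sub_cancel]
  ring

/-- Solutions of the one-variable Euler equation on the positive half-line are monomials. -/
theorem eq_pow_mul_of_euler {g g' : ℝ → ℝ} {n : ℕ} (hg : ∀ t, 0 < t → HasDerivAt g (g' t) t)
    (he : ∀ t, 0 < t → t * g' t = n * g t) {t : ℝ} (ht : 0 < t) : g t = t ^ n * g 1 := by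
  have hd (s : ℝ) (hs : 0 < s) : HasDerivAt (fun s => g s / s ^ n) 0 s := by
    have h0 : g' s * s ^ n - g s * (n * s ^ (n - 1)) = 0 := by
      have := he s hs
      rcases n with _ | k
      · simp_all [hs.ne']
      · rw [Nat.add_sub_cancel, pow_succ]
        linear_combination s ^ k * this
    have hq := (hg s hs).fun_div (hasDerivAt_pow n s) (pow_ne_zero n hs.ne')
    rwa [h0, zero_div] at hq
  have h := isOpen_Ioi.is_const_of_deriv_eq_zero isPreconnected_Ioi
    (fun s hs => (hd s hs).differentiableAt.differentiableWithinAt)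
    (fun s hs => (hd s hs).deriv) (Set.mem_Ioi.2 ht) (Set.mem_Ioi.2 one_pos)
  have htn := pow_ne_zero n ht.ne'
  simp only [one_pow, div_one] at h
  rw [← h]
  field_simp

/-- By continuity, equivariance for positive scalars implies equivariance for
nonnegative scalars. -/
theorem weighted_equivariant_of_pos {ι κ : Type*} {w : ι → ℕ} {v : κ → ℕ}
    {ψ : (ι → ℝ) → (κ → ℝ)} (hψ : Continuous ψ)
    (h : ∀ t : ℝ, 0 < t → ∀ x : ι → ℝ,
      ψ (fun i => t ^ w i * x i) = fun j => t ^ v j * ψ x j)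
    (t : ℝ) (ht : 0 ≤ t) (x : ι → ℝ) :
    ψ (fun i => t ^ w i * x i) = fun j => t ^ v j * ψ x j := by
  have hEq : Set.EqOn (fun s : ℝ => ψ (fun i => s ^ w i * x i))
      (fun s => fun j => s ^ v j * ψ x j) (Set.Ioi 0) := fun s hs => h s hs x
  have hc := hEq.closure (hψ.comp (by fun_prop)) (by fun_prop)
  rw [closure_Ioi] at hc
  exact hc ht


/-- For a smooth map ψ : ℝ^{N₁} → ℝ^{N₂} the following are equivalent:
(a) ψ intertwines the standard weighted actions;
(b) ψ pulls back homogeneous smooth functions of degree r to homogeneous functions of degree r;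
(c) ψ relates the corresponding weight vector fields. -/
theorem stmt_4 (N₁ N₂ : ℕ) (w : Fin N₁ → ℕ) (v : Fin N₂ → ℕ)
    (hw : ∀ i, 1 ≤ w i) (hv : ∀ j, 1 ≤ v j)
    (ψ : (Fin N₁ → ℝ) → (Fin N₂ → ℝ)) (hψ : ContDiff ℝ (⊤ : ℕ∞) ψ) :
    ((∀ t : ℝ, 0 ≤ t → ∀ x : Fin N₁ → ℝ,
        ψ (fun i => t ^ w i * x i) = fun j => t ^ v j * ψ x j) ↔
      (∀ (r : ℕ) (f : (Fin N₂ → ℝ) → ℝ), ContDiff ℝ (⊤ : ℕ∞) f →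
        (∀ t : ℝ, 0 < t → ∀ y : Fin N₂ → ℝ, f (fun j => t ^ v j * y j) = t ^ r * f y) →
        (∀ t : ℝ, 0 < t → ∀ x : Fin N₁ → ℝ,
          f (ψ (fun i => t ^ w i * x i)) = t ^ r * f (ψ x)))) ∧
    ((∀ t : ℝ, 0 ≤ t → ∀ x : Fin N₁ → ℝ,
        ψ (fun i => t ^ w i * x i) = fun j => t ^ v j * ψ x j) ↔
      (∀ x : Fin N₁ → ℝ,
        fderiv ℝ ψ x (fun i => (w i : ℝ) * x i) = fun j => (v j : ℝ) * ψ x j)) := by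
  have hd (x : Fin N₁ → ℝ) : HasFDerivAt ψ (fderiv ℝ ψ x) x :=
    (hψ.differentiable (by simp) x).hasFDerivAt
  refine ⟨⟨fun h r f _ hf t ht x => ?_, fun h => ?_⟩, ⟨fun h x => ?_, fun h => ?_⟩⟩
  · rw [h t ht.le x, hf t ht]
  · refine weighted_equivariant_of_pos hψ.continuous fun t ht x => funext fun j => ?_
    exact h (v j) (fun y => y j) (contDiff_apply ℝ ℝ j) (fun _ _ _ => rfl) t ht x
  · have h₁ : HasDerivAt (fun t : ℝ => ψ (fun i => t ^ w i * x i))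
        (fderiv ℝ ψ x (fun i => (w i : ℝ) * x i)) 1 := by
      have hx : HasFDerivAt ψ (fderiv ℝ ψ x) (fun i => (1 : ℝ) ^ w i * x i) := by
        simpa using hd x
      simpa [Function.comp_def] using
        hx.comp_hasDerivAt (1 : ℝ) (hasDerivAt_weighted_action w x 1)
    have h₂ : HasDerivAt (fun t : ℝ => fun j => t ^ v j * ψ x j)
        (fun j => (v j : ℝ) * ψ x j) 1 := by
      simpa using hasDerivAt_weighted_action v (ψ x) 1
    have hs := uniqueDiffOn_Ici (0 : ℝ) 1 (Set.mem_Ici.2 zero_le_one)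
    exact hs.eq_deriv _ h₁.hasDerivWithinAt
      (h₂.hasDerivWithinAt.congr (fun t ht => h t ht x) (h 1 zero_le_one x))
  · refine weighted_equivariant_of_pos hψ.continuous fun t ht x => funext fun j => ?_
    have hg (s : ℝ) := hasDerivAt_pi.1
      ((hd _).comp_hasDerivAt s (hasDerivAt_weighted_action w x s)) j
    have he (s : ℝ) : s * fderiv ℝ ψ (fun i => s ^ w i * x i)
        (fun i => (w i : ℝ) * s ^ (w i - 1) * x i) j = v j * ψ (fun i => s ^ w i * x i) j := by
      rw [← smul_eq_mul, ← Pi.smul_apply, ← map_smul, smul_deriv_weighted_action hw, h]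
    simpa using eq_pow_mul_of_euler (fun s _ => hg s) (fun s _ => he s) ht
end

section
/- Let w : {1,…,N} → ℕ and w' : {1,…,N'} → ℕ be weight functions with all values ≥ 1, and let δ_t and δ'_t denote the corresponding standard weighted actions on ℝ^N and ℝ^{N'}. There exists a bijection ψ : ℝ^N → ℝ^{N'} with ψ and ψ^{-1} smooth (C^∞) and ψ ∘ δ_t = δ'_t ∘ ψ for all t ≥ 0 if and only if for every j ≥ 1 the number of indices i with w(i) = j equals the number of indices i' with w'(i') = j (in particular N = N'). In other words, two graded spaces are isomorphic if and only if they have the same rank. -/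
/-- An injective linear map intertwining the dilations by `2` does not decrease the number of
coordinates of a given weight. -/
lemma card_weight_le_of_injective {ι ι' : Type*} [Fintype ι] [Fintype ι'] [DecidableEq ι]
    (w : ι → ℕ) (w' : ι' → ℕ) (A : (ι → ℝ) →ₗ[ℝ] (ι' → ℝ)) (hA : Function.Injective A)
    (h : ∀ x, A (fun i => 2 ^ w i * x i) = fun i' => 2 ^ w' i' * A x i') (j : ℕ) :
    (Finset.univ.filter fun i => w i = j).card ≤
      (Finset.univ.filter fun i' => w' i' = j).card := by
  let E : ({i // w i = j} → ℝ) →ₗ[ℝ] (ι → ℝ) :=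
    Function.ExtendByZero.linearMap ℝ Subtype.val
  have hE_mem : ∀ x (i : {i // w i = j}), E x i = x i := fun x i =>
    Subtype.val_injective.extend_apply x 0 i
  have hE_notMem : ∀ x i, w i ≠ j → E x i = 0 := fun x i hi =>
    Function.extend_apply' _ _ _ (by rintro ⟨a, rfl⟩; exact hi a.2)
  have hE_smul : ∀ x, (fun i => 2 ^ w i * E x i) = (2 : ℝ) ^ j • E x := by
    intro x
    funext i
    by_cases hi : w i = j
    · simp [hi]
    · simp [hE_notMem x i hi]
  let B : ({i // w i = j} → ℝ) →ₗ[ℝ] ({i' // w' i' = j} → ℝ) :=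
    LinearMap.funLeft ℝ ℝ Subtype.val ∘ₗ A ∘ₗ E
  have hB : Function.Injective B := by
    rw [← LinearMap.ker_eq_bot, LinearMap.ker_eq_bot']
    intro x hx
    have hAE : A (E x) = 0 := by
      funext i'
      by_cases hi' : w' i' = j
      · exact congrFun hx ⟨i', hi'⟩
      · have key := congrFun (h (E x)) i'
        rw [hE_smul, map_smul, Pi.smul_apply, smul_eq_mul] at key
        by_contra hne
        exact hi' (Nat.pow_right_injective le_rfl
          (by exact_mod_cast (mul_right_cancel₀ hne key).symm))
    have hEx : E x = 0 := hA (hAE.trans (map_zero A).symm)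
    funext i
    rw [← hE_mem x i, hEx, Pi.zero_apply, Pi.zero_apply]
  simpa [Module.finrank_fintype_fun_eq_card, Fintype.card_subtype] using
    LinearMap.finrank_le_finrank_of_injective hB

/-- The derivative at `0` of a map intertwining two weighted dilations intertwines them too. -/
lemma fderiv_zero_intertwines {ι ι' : Type*} [Fintype ι] [Fintype ι']
    (w : ι → ℕ) (w' : ι' → ℕ) (f : (ι → ℝ) → (ι' → ℝ)) (hf : DifferentiableAt ℝ f 0) (t : ℝ)
    (h : ∀ x, f (fun i => t ^ w i * x i) = fun i' => t ^ w' i' * f x i') (x : ι → ℝ) :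
    fderiv ℝ f 0 (fun i => t ^ w i * x i) = fun i' => t ^ w' i' * fderiv ℝ f 0 x i' := by
  let D : (ι → ℝ) →L[ℝ] (ι → ℝ) :=
    ContinuousLinearMap.pi fun i => t ^ w i • ContinuousLinearMap.proj i
  let D' : (ι' → ℝ) →L[ℝ] (ι' → ℝ) :=
    ContinuousLinearMap.pi fun i' => t ^ w' i' • ContinuousLinearMap.proj i'
  have hcomp : f ∘ D = D' ∘ f := funext h
  have h₁ : HasFDerivAt (f ∘ D) ((fderiv ℝ f 0).comp D) 0 := by
    refine HasFDerivAt.comp 0 ?_ D.hasFDerivAt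
    rw [map_zero]
    exact hf.hasFDerivAt
  have h₂ : HasFDerivAt (D' ∘ f) (D'.comp (fderiv ℝ f 0)) 0 :=
    D'.hasFDerivAt.comp 0 hf.hasFDerivAt
  rw [hcomp] at h₁
  exact congrArg (fun L : (ι → ℝ) →L[ℝ] (ι' → ℝ) => L x) (h₁.unique h₂)

/-- A differentiable map with a differentiable left inverse, fixing the origin and intertwining
the dilations by `2`, does not decrease the number of coordinates of a given weight. -/
lemma card_weight_le_of_leftInverse {ι ι' : Type*} [Fintype ι] [Fintype ι'] [DecidableEq ι]
    (w : ι → ℕ) (w' : ι' → ℕ) (f : (ι → ℝ) → (ι' → ℝ)) (g : (ι' → ℝ) → (ι → ℝ))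
    (hgf : Function.LeftInverse g f) (hf : DifferentiableAt ℝ f 0)
    (hg : DifferentiableAt ℝ g 0) (hf₀ : f 0 = 0)
    (h : ∀ x, f (fun i => 2 ^ w i * x i) = fun i' => 2 ^ w' i' * f x i') (j : ℕ) :
    (Finset.univ.filter fun i => w i = j).card ≤
      (Finset.univ.filter fun i' => w' i' = j).card := by
  refine card_weight_le_of_injective w w' (fderiv ℝ f 0 : (ι → ℝ) →ₗ[ℝ] (ι' → ℝ)) ?_
    (fderiv_zero_intertwines w w' f hf 2 h) j
  have hcomp : HasFDerivAt (g ∘ f) ((fderiv ℝ g 0).comp (fderiv ℝ f 0)) 0 := by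
    refine HasFDerivAt.comp 0 ?_ hf.hasFDerivAt
    rw [hf₀]
    exact hg.hasFDerivAt
  rw [hgf.comp_eq_id] at hcomp
  have hid := hcomp.unique (hasFDerivAt_id (𝕜 := ℝ) (0 : ι → ℝ))
  exact Function.LeftInverse.injective (g := fderiv ℝ g 0) fun x =>
    congrArg (fun L : (ι → ℝ) →L[ℝ] (ι → ℝ) => L x) hid

/-- Two graded spaces are isomorphic (there is a diffeomorphism intertwining the standard
weighted actions) if and only if they have the same rank, i.e. for each degree j ≥ 1 the
numbers of coordinates of weight j coincide. -/
theorem stmt_5 (N N' : ℕ) (w : Fin N → ℕ) (w' : Fin N' → ℕ)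
    (hw : ∀ i, 1 ≤ w i) (hw' : ∀ i', 1 ≤ w' i') :
    (∃ ψ : (Fin N → ℝ) ≃ (Fin N' → ℝ),
      ContDiff ℝ (⊤ : ℕ∞) ψ ∧ ContDiff ℝ (⊤ : ℕ∞) ψ.symm ∧
      ∀ t : ℝ, 0 ≤ t → ∀ x : Fin N → ℝ,
        ψ (fun i => t ^ w i * x i) = fun i' => t ^ w' i' * ψ x i') ↔
    (∀ j : ℕ, 1 ≤ j →
      (Finset.univ.filter fun i => w i = j).card =
        (Finset.univ.filter fun i' => w' i' = j).card) := by
  constructor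
  · rintro ⟨ψ, hψ, hψs, h⟩ j -
    have hψ₀ : ψ 0 = 0 := by
      have h₀ := h 0 le_rfl 0
      simp only [Pi.zero_apply, mul_zero] at h₀
      refine h₀.trans (funext fun i' => ?_)
      rw [zero_pow (Nat.one_le_iff_ne_zero.mp (hw' i')), zero_mul, Pi.zero_apply]
    have hψs₀ : ψ.symm 0 = 0 := by rw [Equiv.symm_apply_eq, hψ₀]
    have hs : ∀ y, ψ.symm (fun i' => 2 ^ w' i' * y i') = fun i => 2 ^ w i * ψ.symm y i := by
      intro y
      rw [Equiv.symm_apply_eq, h 2 zero_le_two, Equiv.apply_symm_apply]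
    have hd : DifferentiableAt ℝ ψ 0 := (hψ.differentiable (by simp)).differentiableAt
    have hds : DifferentiableAt ℝ ψ.symm 0 := (hψs.differentiable (by simp)).differentiableAt
    exact le_antisymm
      (card_weight_le_of_leftInverse w w' ψ ψ.symm ψ.left_inv hd hds hψ₀ (h 2 zero_le_two) j)
      (card_weight_le_of_leftInverse w' w ψ.symm ψ ψ.right_inv hds hd hψs₀ hs j)
  · intro h
    have hcard : ∀ j, Fintype.card {i // w i = j} = Fintype.card {i' // w' i' = j} := by
      intro j
      rw [Fintype.card_subtype, Fintype.card_subtype]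
      rcases Nat.eq_zero_or_pos j with rfl | hj
      · simp [Nat.one_le_iff_ne_zero.mp (hw _), Nat.one_le_iff_ne_zero.mp (hw' _)]
      · exact h j hj
    let e : Fin N ≃ Fin N' := Equiv.ofFiberEquiv fun j => Fintype.equivOfCardEq (hcard j)
    have he : ∀ i, w' (e i) = w i := Equiv.ofFiberEquiv_map _
    refine ⟨e.arrowCongr (Equiv.refl ℝ), ?_, ?_, ?_⟩
    · exact contDiff_pi.mpr fun i' => contDiff_apply ℝ ℝ (e.symm i')
    · exact contDiff_pi.mpr fun i => contDiff_apply ℝ ℝ (e i)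
    · intro t _ x
      funext i'
      have hi' : w (e.symm i') = w' i' := by rw [← he, Equiv.apply_symm_apply]
      simp [Equiv.arrowCongr_apply, hi']
end

section
/- Let ε > 0, let θ ∈ ℝ^D, let r ≥ 1, and let h : ℝ × ℝ^D → ℝ^D be smooth (C^∞) such that h(t, h(s, x)) = h(ts, x) whenever 0 ≤ t, s, ts < ε, and h(0, x) = θ for all x. Assume that for every x ∈ ℝ^D and every 1 ≤ j ≤ r−1 the j-th derivative of t ↦ h(t, x) at t = 0 vanishes, and define ψ : ℝ^D → ℝ^D by ψ(x) = (1/r!) · (the r-th derivative of t ↦ h(t, x) at t = 0). Then: (i) ψ(h(t, x)) = t^r · ψ(x) for all x and all 0 ≤ t < ε; (ii) the derivative Q := Dψ(θ) is a linear projection, Q ∘ Q = Q; (iii) Q(ψ(x)) = ψ(x) for all x; and (iv) if moreover ψ(x) = 0 only for x = θ, then Q is the identity map of ℝ^D. -/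
open Filter Topology Set

section

variable {E F : Type*} [NormedAddCommGroup E] [NormedSpace ℝ E]
  [NormedAddCommGroup F] [NormedSpace ℝ F]

/-- Iterated partial derivatives in a real parameter of a jointly smooth map are jointly smooth. -/
lemma ContDiff.iteratedDeriv_fst {h : ℝ × E → F} (hsm : ContDiff ℝ (⊤ : ℕ∞) h) (n : ℕ) :
    ContDiff ℝ (⊤ : ℕ∞) (fun p : ℝ × E => iteratedDeriv n (fun t : ℝ => h (t, p.2)) p.1) := by
  induction n with
  | zero => simpa using hsm
  | succ n ih =>
    set g : ℝ × E → F := fun p => iteratedDeriv n (fun t : ℝ => h (t, p.2)) p.1 with hg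
    have key : (fun p : ℝ × E => iteratedDeriv (n + 1) (fun t : ℝ => h (t, p.2)) p.1)
        = fun p => fderiv ℝ g p (1, 0) := by
      funext p
      rw [iteratedDeriv_succ]
      have h1 : HasFDerivAt g (fderiv ℝ g p) (p.1, p.2) :=
        (ih.differentiable (by simp) p).hasFDerivAt
      have h2 : HasDerivAt (fun t : ℝ => (t, p.2)) ((1 : ℝ), (0 : E)) p.1 :=
        (hasDerivAt_id p.1).prodMk (hasDerivAt_const p.1 p.2)
      exact (h1.comp_hasDerivAt p.1 h2).deriv
    rw [key]
    exact (ih.fderiv_right (m := (⊤ : ℕ∞)) (by simp)).clm_apply contDiff_const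

/-- Smooth functions agreeing on a right half-neighbourhood of `0` have equal derivatives there. -/
lemma iteratedDeriv_zero_eq_of_eqOn_Ico {f g : ℝ → F} {n : ℕ} {δ : ℝ} (hδ : 0 < δ)
    (hf : ContDiff ℝ n f) (hg : ContDiff ℝ n g) (hfg : EqOn f g (Ico 0 δ)) :
    iteratedDeriv n f 0 = iteratedDeriv n g 0 := by
  have h0 : (0 : ℝ) ∈ Ico 0 δ := ⟨le_rfl, hδ⟩
  rw [← iteratedDerivWithin_eq_iteratedDeriv (uniqueDiffOn_Ico 0 δ) hf.contDiffAt h0,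
    ← iteratedDerivWithin_eq_iteratedDeriv (uniqueDiffOn_Ico 0 δ) hg.contDiffAt h0]
  exact iteratedDerivWithin_congr hfg h0

/-- If the derivatives of `f` at `0` of orders `1, …, r - 1` vanish, then `(f t - f 0) / t ^ r`
tends to the Taylor coefficient of order `r`. -/
lemma tendsto_inv_pow_smul_sub_of_iteratedDeriv_eq_zero {f : ℝ → F} {r : ℕ} (hr : 1 ≤ r)
    (hf : ContDiff ℝ r f) (hflat : ∀ j : ℕ, 1 ≤ j → j ≤ r - 1 → iteratedDeriv j f 0 = 0) :
    Tendsto (fun t : ℝ => (t ^ r)⁻¹ • (f t - f 0)) (𝓝[>] 0)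
      (𝓝 ((Nat.factorial r : ℝ)⁻¹ • iteratedDeriv r f 0)) := by
  have h1 := taylor_tendsto (x₀ := 0) convex_univ (mem_univ _) hf.contDiffOn
  rw [nhdsWithin_univ] at h1
  have h2 := (h1.mono_left (nhdsWithin_le_nhds (s := Ioi 0))).add_const
    ((Nat.factorial r : ℝ)⁻¹ • iteratedDeriv r f 0)
  rw [zero_add] at h2
  refine h2.congr' ?_
  filter_upwards [self_mem_nhdsWithin] with t ht
  have ht : t ^ r ≠ 0 := pow_ne_zero _ (ne_of_gt ht)
  have h3 : taylorWithinEval f r univ 0 t =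
      f 0 + t ^ r • ((Nat.factorial r : ℝ)⁻¹ • iteratedDeriv r f 0) := by
    obtain ⟨m, rfl⟩ : ∃ m, r = m + 1 := ⟨r - 1, by omega⟩
    rw [taylor_within_apply, Finset.sum_range_succ, Finset.sum_range_succ', Finset.sum_eq_zero]
    · simp [iteratedDerivWithin_univ, smul_smul, mul_comm]
    · intro j hj
      rw [Finset.mem_range] at hj
      rw [iteratedDerivWithin_univ, hflat (j + 1) (by omega) (by omega), smul_zero]
  rw [h3, sub_zero, ← sub_sub, smul_sub, inv_smul_smul₀ ht, sub_add_cancel]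

/-- If the derivative `Q` of `f` at a zero `a` is a projection fixing the values of `f`, and `a` is
the only zero of `f`, then `Q` is the identity. -/
lemma HasStrictFDerivAt.eq_id_of_unique_zero [CompleteSpace E] {f : E → E} {Q : E →L[ℝ] E} {a : E}
    (hf : HasStrictFDerivAt f Q a) (ha : f a = 0) (hQf : ∀ x, Q (f x) = f x)
    (hQ : ∀ v, Q (Q v) = Q v) (huniq : ∀ x, f x = 0 → x = a) (v : E) : Q v = v := by
  set G : E → E := fun x => f x + ((x - a) - Q (x - a)) with hG
  have hGa : G a = 0 := by simp [hG, ha]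
  have hG' : HasStrictFDerivAt G ((ContinuousLinearEquiv.refl ℝ E : E ≃L[ℝ] E) : E →L[ℝ] E) a := by
    have h1 : HasStrictFDerivAt (fun x : E => x - a) (ContinuousLinearMap.id ℝ E) a :=
      (hasStrictFDerivAt_id a).sub_const a
    have h2 := hf.add (h1.sub (Q.hasStrictFDerivAt.comp a h1))
    refine h2.congr_fderiv ?_
    ext x
    simp
  have hmap := hG'.map_nhds_eq_of_equiv
  rw [hGa] at hmap
  have hrange : ∀ᶠ y in 𝓝 (0 : E), ∃ x, G x = y := by
    rw [← hmap]
    exact eventually_map.mpr (Eventually.of_forall fun x => ⟨x, rfl⟩)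
  have hlim : Tendsto (fun s : ℝ => s • (v - Q v)) (𝓝[≠] 0) (𝓝 0) := by
    have : Continuous fun s : ℝ => s • (v - Q v) := by fun_prop
    simpa using (this.tendsto 0).mono_left nhdsWithin_le_nhds
  obtain ⟨s, ⟨x, hx⟩, hs⟩ := ((hlim.eventually hrange).and self_mem_nhdsWithin).exists
  have hfx : f x = 0 := by
    have := congrArg Q hx
    simpa [hG, hQf, hQ] using this
  rw [huniq x hfx, hGa] at hx
  have := (smul_eq_zero.mp hx.symm).resolve_left hs
  exact (sub_eq_zero.mp this).symm

/-- If a map `f` takes values in the fixed space of its derivative at some point, this derivative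
is idempotent. -/
lemma HasFDerivAt.apply_apply_of_apply_eq {f : E → E} {Q : E →L[ℝ] E} {a : E}
    (hf : HasFDerivAt f Q a) (hQf : ∀ x, Q (f x) = f x) (v : E) : Q (Q v) = Q v := by
  have h1 : HasFDerivAt (fun x => Q (f x)) (Q.comp Q) a := Q.hasFDerivAt.comp a hf
  simp only [hQf] at h1
  exact DFunLike.congr_fun (h1.unique hf) v

end


/-- The key lemma on local smooth actions of (ℝ_{≥0},·) on ℝ^D with a single fixed point θ:
if all derivatives of t ↦ h(t,x) at 0 of orders < r vanish, then the r-th Taylor coefficient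
ψ satisfies ψ(h(t,x)) = t^r ψ(x), its derivative Q at θ is a projection fixing the image of ψ,
and Q is the identity provided ψ vanishes only at θ. -/
theorem stmt_8 (D : ℕ) (ε : ℝ) (hε : 0 < ε) (θ : Fin D → ℝ) (r : ℕ) (hr : 1 ≤ r)
    (h : ℝ × (Fin D → ℝ) → (Fin D → ℝ)) (hsm : ContDiff ℝ (⊤ : ℕ∞) h)
    (hact : ∀ t s : ℝ, 0 ≤ t → 0 ≤ s → t < ε → s < ε → t * s < ε →
      ∀ x : Fin D → ℝ, h (t, h (s, x)) = h (t * s, x))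
    (hzero : ∀ x : Fin D → ℝ, h (0, x) = θ)
    (hflat : ∀ x : Fin D → ℝ, ∀ j : ℕ, 1 ≤ j → j ≤ r - 1 →
      iteratedDeriv j (fun t : ℝ => h (t, x)) 0 = 0)
    (ψ : (Fin D → ℝ) → (Fin D → ℝ))
    (hψ : ∀ x : Fin D → ℝ,
      ψ x = ((Nat.factorial r : ℝ))⁻¹ • iteratedDeriv r (fun t : ℝ => h (t, x)) 0) :
    (∀ x : Fin D → ℝ, ∀ t : ℝ, 0 ≤ t → t < ε → ψ (h (t, x)) = t ^ r • ψ x) ∧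
    ((fderiv ℝ ψ θ).comp (fderiv ℝ ψ θ) = fderiv ℝ ψ θ) ∧
    (∀ x : Fin D → ℝ, fderiv ℝ ψ θ (ψ x) = ψ x) ∧
    ((∀ x : Fin D → ℝ, ψ x = 0 → x = θ) → ∀ v : Fin D → ℝ, fderiv ℝ ψ θ v = v) := by
  have hcurve (x : Fin D → ℝ) : ContDiff ℝ r fun t : ℝ => h (t, x) :=
    (hsm.comp (contDiff_id.prodMk contDiff_const)).of_le (by exact_mod_cast le_top)
  have hψsm : ContDiff ℝ (⊤ : ℕ∞) ψ := by
    rw [funext hψ]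
    exact ((hsm.iteratedDeriv_fst r).comp
      ((contDiff_const (c := (0 : ℝ))).prodMk contDiff_id)).const_smul _
  have hhom : ∀ x : Fin D → ℝ, ∀ t : ℝ, 0 ≤ t → t < ε → ψ (h (t, x)) = t ^ r • ψ x := by
    intro x s hs0 hs
    have hs1 : 0 < s + 1 := by linarith
    have key : iteratedDeriv r (fun t : ℝ => h (t, h (s, x))) 0 =
        iteratedDeriv r (fun t : ℝ => h (s * t, x)) 0 := by
      refine iteratedDeriv_zero_eq_of_eqOn_Ico (δ := min ε (ε / (s + 1))) (by positivity)
        (hcurve _) ((hcurve x).comp (contDiff_const.mul contDiff_id)) fun t ht => ?_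
      have ht2 : t * (s + 1) < ε :=
        (lt_div_iff₀ hs1).mp (ht.2.trans_le (min_le_right _ _))
      have := hact t s ht.1 hs0 (ht.2.trans_le (min_le_left _ _)) hs (by linarith [ht.1]) x
      simpa [mul_comm] using this
    have hscale := congrFun (iteratedDeriv_comp_const_smul (hcurve x) s) 0
    simp only [mul_zero] at hscale
    rw [hψ, hψ, key, hscale, smul_comm]
  have hψθ : ψ θ = 0 := by
    have := hhom θ 0 le_rfl hε
    rwa [hzero, zero_pow (by omega), zero_smul] at this
  have hstrict : HasStrictFDerivAt ψ (fderiv ℝ ψ θ) θ :=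
    hψsm.contDiffAt.hasStrictFDerivAt (by simp)
  have hfix : ∀ x : Fin D → ℝ, fderiv ℝ ψ θ (ψ x) = ψ x := by
    intro x
    have htaylor := tendsto_inv_pow_smul_sub_of_iteratedDeriv_eq_zero hr (hcurve x) (hflat x)
    rw [← hψ] at htaylor
    simp only [hzero] at htaylor
    have hd : Tendsto (fun t : ℝ => h (t, x) - θ) (𝓝[>] 0) (𝓝 0) := by
      have := ((hcurve x).continuous.tendsto 0).sub_const θ
      rw [hzero, sub_self] at this
      exact this.mono_left nhdsWithin_le_nhds
    have hlim := hstrict.hasFDerivAt.hasFDerivWithinAt.lim (s := univ) hd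
      (Eventually.of_forall fun _ => mem_univ _) htaylor
    refine tendsto_nhds_unique hlim (tendsto_const_nhds.congr' ?_)
    filter_upwards [Ioo_mem_nhdsGT hε] with t ht
    rw [add_sub_cancel, hψθ, sub_zero, hhom x t ht.1.le ht.2,
      inv_smul_smul₀ (pow_ne_zero _ ht.1.ne')]
  have hproj := hstrict.hasFDerivAt.apply_apply_of_apply_eq hfix
  exact ⟨hhom, ContinuousLinearMap.ext hproj, hfix,
    hstrict.eq_id_of_unique_zero hψθ hfix hproj⟩
end

section
/- Let w : {1,…,N} → ℕ be a weight function and let δ_t denote the standard weighted action on ℝ^N. Suppose g : ℝ × ℝ^N → ℝ^N is smooth (C^∞), satisfies g(t, g(s, x)) = g(ts, x) for all t, s ∈ ℝ, and agrees with the standard action for non-negative parameters: g(t, x) = δ_t(x) for all t ≥ 0 and all x. Then g(t, x)_i = t^{w(i)} x_i for all t ∈ ℝ, x ∈ ℝ^N and 1 ≤ i ≤ N; in particular, g(−1, x)_i = (−1)^{w(i)} x_i. Hence the action of (ℝ_{≥0}, ·) by the standard weighted action extends uniquely to a smooth action of the multiplicative monoid (ℝ, ·). -/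
open Filter Topology in
/-- A smooth function on the line that is a multiple of `t ^ n` on each open half-line has the same
coefficient on both sides. -/
theorem coeff_eq_of_contDiff_of_eq_mul_pow (n : ℕ) {a b : ℝ} {f : ℝ → ℝ}
    (hf : ContDiff ℝ (⊤ : ℕ∞) f) (hpos : ∀ t, 0 < t → f t = a * t ^ n)
    (hneg : ∀ t, t < 0 → f t = b * t ^ n) : a = b := by
  induction n generalizing a b f with
  | zero =>
    have hright : Tendsto f (𝓝[>] 0) (𝓝 a) :=
      tendsto_const_nhds.congr' <| by
        filter_upwards [self_mem_nhdsWithin] with t ht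
        simp [hpos t ht]
    have hleft : Tendsto f (𝓝[<] 0) (𝓝 b) :=
      tendsto_const_nhds.congr' <| by
        filter_upwards [self_mem_nhdsWithin] with t ht
        simp [hneg t ht]
    have hc : Tendsto f (𝓝 0) (𝓝 (f 0)) := hf.continuous.tendsto 0
    exact (tendsto_nhds_unique hright (hc.mono_left nhdsWithin_le_nhds)).trans
      (tendsto_nhds_unique hleft (hc.mono_left nhdsWithin_le_nhds)).symm
  | succ n ih =>
    have hderiv (c t : ℝ) : deriv (fun s : ℝ => c * s ^ (n + 1)) t = c * (n + 1) * t ^ n := by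
      simp [mul_assoc]
    have h : a * (n + 1) = b * (n + 1) := by
      refine ih (f := deriv f) (contDiff_infty_iff_deriv.mp hf).2 (fun t ht => ?_) fun t ht => ?_
      · rw [← hderiv]
        exact EventuallyEq.deriv_eq ((eventually_gt_nhds ht).mono hpos)
      · rw [← hderiv]
        exact EventuallyEq.deriv_eq ((eventually_lt_nhds ht).mono hneg)
    exact mul_right_cancel₀ (by positivity) h

/-- The standard weighted action of (ℝ_{≥0},·) on ℝ^N extends uniquely to a smooth action of
the multiplicative monoid (ℝ,·): any smooth action g of (ℝ,·) agreeing with the standard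
weighted action for non-negative parameters is given by g(t,x)_i = t^{w(i)} x_i for all t ∈ ℝ;
in particular g(−1,x)_i = (−1)^{w(i)} x_i. -/
theorem stmt_11 (N : ℕ) (w : Fin N → ℕ)
    (g : ℝ × (Fin N → ℝ) → (Fin N → ℝ)) (hsm : ContDiff ℝ (⊤ : ℕ∞) g)
    (hact : ∀ t s : ℝ, ∀ x : Fin N → ℝ, g (t, g (s, x)) = g (t * s, x))
    (hagree : ∀ t : ℝ, 0 ≤ t → ∀ x : Fin N → ℝ, ∀ i, g (t, x) i = t ^ w i * x i) :
    ∀ t : ℝ, ∀ x : Fin N → ℝ, ∀ i, g (t, x) i = t ^ w i * x i := by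
  intro t x i
  have hneg (s : ℝ) (hs : s ≤ 0) : g (s, x) i = (-1) ^ w i * g (-1, x) i * s ^ w i := by
    have h := hagree (-s) (neg_nonneg.mpr hs) (g (-1, x)) i
    rw [hact, neg_mul_neg, mul_one, neg_pow] at h
    rw [h]
    ring
  have hsmooth : ContDiff ℝ (⊤ : ℕ∞) fun s : ℝ => g (s, x) i :=
    (contDiff_apply ℝ ℝ i).comp (hsm.comp (contDiff_id.prodMk contDiff_const))
  have hcoeff : x i = (-1) ^ w i * g (-1, x) i :=
    coeff_eq_of_contDiff_of_eq_mul_pow (w i) hsmooth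
      (fun s hs => (hagree s hs.le x i).trans (mul_comm _ _)) fun s hs => hneg s hs.le
  rcases le_total 0 t with ht | ht
  · exact hagree t ht x i
  · rw [hneg t ht, ← hcoeff, mul_comm]
end

section
/- Let E be a finite-dimensional real vector space and let H : ℝ → End(E) be a smooth (C^∞) family of linear endomorphisms of E such that H(ts) = H(t) ∘ H(s) for all t, s ≥ 0 and H(1) = id_E. Then there exist an integer n ≥ 0 and linear projections P_0, P_1, …, P_n ∈ End(E) with P_r ∘ P_r = P_r, P_r ∘ P_s = 0 for r ≠ s, and P_0 + P_1 + ⋯ + P_n = id_E, such that H(t) = Σ_{r=0}^{n} t^r · P_r for all t ≥ 0. Equivalently, E decomposes as a direct sum E = E_0 ⊕ E_1 ⊕ ⋯ ⊕ E_n where E_r is the image of P_r and H(t) acts on E_r as multiplication by t^r. -/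
open Filter Topology Asymptotics

/-- A polynomial of degree at most `n` that is `o(t ^ n)` as `t → 0⁺` has zero constant term. -/
theorem coeff_zero_eq_zero_of_sum_isLittleO {F : Type*} [NormedAddCommGroup F] [NormedSpace ℝ F]
    {n : ℕ} {c : ℕ → F}
    (h : (fun t : ℝ => ∑ r ∈ Finset.range (n + 1), t ^ r • c r) =o[𝓝[>] 0] fun t => t ^ n) :
    c 0 = 0 := by
  have hlim : Tendsto (fun t : ℝ => ∑ r ∈ Finset.range (n + 1), t ^ r • c r)
      (𝓝[>] 0) (𝓝 (c 0)) := by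
    have hcont : Continuous fun t : ℝ => ∑ r ∈ Finset.range (n + 1), t ^ r • c r := by
      fun_prop
    have := hcont.tendsto 0
    rw [Finset.sum_range_succ'] at this
    simp only [ne_eq, Nat.add_eq_zero_iff, one_ne_zero, and_false, not_false_eq_true, zero_pow,
      zero_smul, Finset.sum_const_zero, pow_zero, one_smul, zero_add] at this
    exact this.mono_left nhdsWithin_le_nhds
  have hO : (fun t : ℝ => t ^ n) =O[𝓝[>] 0] fun _ => (1 : ℝ) :=
    (((continuous_pow n).tendsto (0 : ℝ)).mono_left nhdsWithin_le_nhds).isBigO_one ℝ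
  exact tendsto_nhds_unique hlim ((isLittleO_one_iff ℝ).1 (h.trans_isBigO hO))

/-- A polynomial of degree at most `n` that is `o(t ^ n)` as `t → 0⁺` has zero coefficients. -/
theorem coeff_eq_zero_of_sum_isLittleO {F : Type*} [NormedAddCommGroup F] [NormedSpace ℝ F]
    (n : ℕ) (c : ℕ → F)
    (h : (fun t : ℝ => ∑ r ∈ Finset.range (n + 1), t ^ r • c r) =o[𝓝[>] 0] fun t => t ^ n) :
    ∀ r ∈ Finset.range (n + 1), c r = 0 := by
  have hc0 := coeff_zero_eq_zero_of_sum_isLittleO h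
  induction n generalizing c with
  | zero => simpa using hc0
  | succ n ih =>
    have hshift : (fun t : ℝ => ∑ r ∈ Finset.range (n + 1), t ^ r • c (r + 1))
        =o[𝓝[>] 0] fun t => t ^ n := by
      rw [isLittleO_iff] at h ⊢
      intro ε hε
      filter_upwards [h hε, self_mem_nhdsWithin] with t ht (htpos : 0 < t)
      have hfactor : ∑ r ∈ Finset.range (n + 1 + 1), t ^ r • c r
          = t • ∑ r ∈ Finset.range (n + 1), t ^ r • c (r + 1) := by
        rw [Finset.sum_range_succ', hc0, smul_zero, add_zero, Finset.smul_sum]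
        exact Finset.sum_congr rfl fun r _ => by rw [smul_smul, pow_succ']
      rw [hfactor, norm_smul, pow_succ', norm_mul, mul_left_comm] at ht
      exact le_of_mul_le_mul_left ht (norm_pos_iff.2 htpos.ne')
    have := ih (fun r => c (r + 1)) hshift (coeff_zero_eq_zero_of_sum_isLittleO hshift)
    intro r hr
    cases r with
    | zero => exact hc0
    | succ r => exact this r (by simpa using hr)

/-- Taylor expansion at `0` of a smooth curve, with remainder bound on `[0, 1]`. -/
theorem exists_taylor_coeff_bound {F : Type*} [NormedAddCommGroup F] [NormedSpace ℝ F]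
    {f : ℝ → F} (hf : ContDiff ℝ (⊤ : ℕ∞) f) (n : ℕ) :
    ∃ (Q : ℕ → F) (C : ℝ), ∀ t ∈ Set.Icc (0 : ℝ) 1,
      ‖f t - ∑ r ∈ Finset.range (n + 1), t ^ r • Q r‖ ≤ C * t ^ (n + 1) := by
  obtain ⟨C, hC⟩ := exists_taylor_mean_remainder_bound (n := n) (zero_le_one' ℝ)
    ((hf.of_le (by exact_mod_cast le_top)).contDiffOn)
  refine ⟨fun r => (r.factorial : ℝ)⁻¹ • iteratedDerivWithin r f (Set.Icc 0 1) 0, C,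
    fun t ht => ?_⟩
  have := hC t ht
  rw [taylor_within_apply] at this
  simpa [smul_smul, mul_comm] using this

/-- If a multiplicative family has a Taylor polynomial `∑ t ^ r • Q r` at `0`, then
`Q r * H s = s ^ r • Q r`. -/
theorem taylor_coeff_mul {A : Type*} [NormedRing A] [NormedAlgebra ℝ A] {H : ℝ → A}
    (hmul : ∀ t s : ℝ, 0 ≤ t → 0 ≤ s → H (t * s) = H t * H s) {n : ℕ} {Q : ℕ → A} {C : ℝ}
    (hQ : ∀ t ∈ Set.Icc (0 : ℝ) 1,
      ‖H t - ∑ r ∈ Finset.range (n + 1), t ^ r • Q r‖ ≤ C * t ^ (n + 1))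
    {s : ℝ} (hs : 0 ≤ s) : ∀ r ∈ Finset.range (n + 1), Q r * H s = s ^ r • Q r := by
  have hrem : (fun t => H t - ∑ r ∈ Finset.range (n + 1), t ^ r • Q r)
      =O[𝓝[≥] 0] fun t => t ^ (n + 1) := by
    refine IsBigO.of_bound C ?_
    filter_upwards [Icc_mem_nhdsGE (zero_lt_one' ℝ)] with t ht
    rw [Real.norm_of_nonneg (pow_nonneg ht.1 _)]
    exact hQ t ht
  have hlittle : (fun t : ℝ => t ^ (n + 1)) =o[𝓝[>] 0] fun t => t ^ n :=
    (isLittleO_pow_pow n.lt_succ_self).mono nhdsWithin_le_nhds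
  have hleft := (hrem.mono (nhdsWithin_mono 0 Set.Ioi_subset_Ici_self)).trans_isLittleO hlittle
  have hscale : Tendsto (fun t : ℝ => t * s) (𝓝[>] 0) (𝓝[≥] 0) := by
    refine tendsto_nhdsWithin_iff.2 ⟨?_, ?_⟩
    · have : Tendsto (fun t : ℝ => t * s) (𝓝 0) (𝓝 0) := by
        simpa using (continuous_mul_const s).tendsto (0 : ℝ)
      exact this.mono_left nhdsWithin_le_nhds
    · filter_upwards [self_mem_nhdsWithin] with t ht
      exact mul_nonneg (le_of_lt ht) hs
  have hright : (fun t => H (t * s) - ∑ r ∈ Finset.range (n + 1), (t * s) ^ r • Q r)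
      =o[𝓝[>] 0] fun t => t ^ n := by
    refine ((hrem.comp_tendsto hscale).trans ?_).trans_isLittleO hlittle
    have : ((fun t : ℝ => t ^ (n + 1)) ∘ fun t => t * s)
        = fun t => s ^ (n + 1) * t ^ (n + 1) := by
      ext t; simp only [Function.comp_apply]; ring
    rw [this]
    exact isBigO_const_mul_self _ _ _
  have hleft' : (fun t => (H t - ∑ r ∈ Finset.range (n + 1), t ^ r • Q r) * H s)
      =o[𝓝[>] 0] fun t => t ^ n := by
    simpa using hleft.mul_isBigO (isBigO_const_const (H s) (one_ne_zero' ℝ) (𝓝[>] (0 : ℝ)))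
  have hdiff := hright.sub hleft'
  intro r hr
  refine sub_eq_zero.1 (coeff_eq_zero_of_sum_isLittleO n
    (fun r => Q r * H s - s ^ r • Q r) (hdiff.congr' ?_ .rfl) r hr)
  filter_upwards [self_mem_nhdsWithin] with t ht
  simp only [hmul t s (le_of_lt ht) hs, sub_mul, Finset.sum_mul, smul_sub, Finset.sum_sub_distrib,
    smul_mul_assoc, mul_pow, smul_smul]
  abel

/-- A multiplicative family coincides with its Taylor polynomial at `0` as soon as the degree is
large compared with the growth of `H`. -/
theorem eq_taylor_of_norm_lt {A : Type*} [NormedRing A] [NormedAlgebra ℝ A] {H : ℝ → A}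
    (hmul : ∀ t s : ℝ, 0 ≤ t → 0 ≤ s → H (t * s) = H t * H s) (hone : H 1 = 1)
    {n : ℕ} (hn : ‖H 2‖ < 2 ^ (n + 1)) {Q : ℕ → A} {C : ℝ}
    (hQ : ∀ t ∈ Set.Icc (0 : ℝ) 1,
      ‖H t - ∑ r ∈ Finset.range (n + 1), t ^ r • Q r‖ ≤ C * t ^ (n + 1))
    {s : ℝ} (hs : 0 ≤ s) : H s = ∑ r ∈ Finset.range (n + 1), s ^ r • Q r := by
  have hpow (k : ℕ) : H (2 ^ k) = H 2 ^ k := by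
    induction k with
    | zero => simpa using hone
    | succ k ih => rw [pow_succ, hmul _ _ (by positivity) (by positivity), ih, pow_succ]
  have hsplit (k : ℕ) : H s - ∑ r ∈ Finset.range (n + 1), s ^ r • Q r
      = (H (s / 2 ^ k) - ∑ r ∈ Finset.range (n + 1), (s / 2 ^ k) ^ r • Q r) * H 2 ^ k := by
    rw [sub_mul, ← hpow, ← hmul _ _ (by positivity) (by positivity),
      div_mul_cancel₀ _ (by positivity), Finset.sum_mul]
    congr 1
    refine Finset.sum_congr rfl fun r hr => ?_
    rw [smul_mul_assoc, taylor_coeff_mul hmul hQ (by positivity) r hr, smul_smul, ← mul_pow,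
      div_mul_cancel₀ _ (by positivity)]
  have hsmall : ∀ᶠ k : ℕ in atTop, s / 2 ^ k ≤ 1 := by
    filter_upwards [(tendsto_pow_atTop_atTop_of_one_lt (one_lt_two (α := ℝ))).eventually_ge_atTop s]
      with k hk
    exact div_le_one_of_le₀ hk (by positivity)
  have hlim : Tendsto (fun k : ℕ => C * s ^ (n + 1) * (‖H 2‖ / 2 ^ (n + 1)) ^ k) atTop (𝓝 0) := by
    simpa using (tendsto_pow_atTop_nhds_zero_of_lt_one (by positivity)
      ((div_lt_one (by positivity)).2 hn)).const_mul (C * s ^ (n + 1))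
  have hbound : ∀ᶠ k : ℕ in atTop, ‖H s - ∑ r ∈ Finset.range (n + 1), s ^ r • Q r‖
      ≤ C * s ^ (n + 1) * (‖H 2‖ / 2 ^ (n + 1)) ^ k := by
    filter_upwards [hsmall, eventually_gt_atTop 0] with k hk hkpos
    rw [hsplit k]
    calc _ ≤ _ := norm_mul_le _ _
      _ ≤ C * (s / 2 ^ k) ^ (n + 1) * ‖H 2‖ ^ k :=
        mul_le_mul (hQ _ ⟨by positivity, hk⟩) (norm_pow_le' _ hkpos) (norm_nonneg _)
          ((norm_nonneg _).trans (hQ _ ⟨by positivity, hk⟩))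
      _ = _ := by
        rw [div_pow, div_pow, ← pow_mul, ← pow_mul, mul_comm k]
        ring
  exact sub_eq_zero.1 (norm_le_zero_iff.1 (ge_of_tendsto hlim hbound))


/-- A smooth one-parameter family of endomorphisms H of a finite-dimensional real vector space
satisfying H(ts) = H(t)H(s) for t,s ≥ 0 and H(1) = id decomposes as H(t) = Σ_r t^r P_r for a
family of pairwise annihilating projections P_0,…,P_n summing to the identity. -/
theorem stmt_12 {E : Type*} [NormedAddCommGroup E] [NormedSpace ℝ E]
    [FiniteDimensional ℝ E]
    (H : ℝ → E →L[ℝ] E) (hH : ContDiff ℝ (⊤ : ℕ∞) H)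
    (hmul : ∀ t s : ℝ, 0 ≤ t → 0 ≤ s → H (t * s) = (H t).comp (H s))
    (hone : H 1 = ContinuousLinearMap.id ℝ E) :
    ∃ (n : ℕ) (P : Fin (n + 1) → E →L[ℝ] E),
      (∀ r, (P r).comp (P r) = P r) ∧
      (∀ r s, r ≠ s → (P r).comp (P s) = 0) ∧
      (∑ r, P r = ContinuousLinearMap.id ℝ E) ∧
      (∀ t : ℝ, 0 ≤ t → H t = ∑ r : Fin (n + 1), t ^ (r : ℕ) • P r) := by
  obtain ⟨n, hn⟩ := pow_unbounded_of_one_lt ‖H 2‖ (one_lt_two (α := ℝ))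
  replace hn : ‖H 2‖ < 2 ^ (n + 1) :=
    hn.trans_le (pow_le_pow_right₀ one_le_two n.le_succ)
  obtain ⟨Q, C, hQ⟩ := exists_taylor_coeff_bound hH n
  have hexp (s : ℝ) (hs : 0 ≤ s) : H s = ∑ r ∈ Finset.range (n + 1), s ^ r • Q r :=
    eq_taylor_of_norm_lt hmul hone hn hQ hs
  have horth : ∀ r ∈ Finset.range (n + 1), ∀ m ∈ Finset.range (n + 1),
      Q r * Q m = if m = r then Q r else 0 := by
    intro r hr m hm
    refine sub_eq_zero.1 (coeff_eq_zero_of_sum_isLittleO n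
      (fun m => Q r * Q m - if m = r then Q r else 0) ?_ m hm)
    refine (isLittleO_zero _ _).congr' ?_ .rfl
    filter_upwards [self_mem_nhdsWithin] with t ht
    have h := taylor_coeff_mul hmul hQ (le_of_lt ht) r hr
    rw [hexp t (le_of_lt ht), Finset.mul_sum] at h
    simp only [mul_smul_comm] at h
    simp only [smul_sub, Finset.sum_sub_distrib, h, smul_ite, smul_zero, Finset.sum_ite_eq', hr,
      if_true, sub_self]
  have hmem (r : Fin (n + 1)) : (r : ℕ) ∈ Finset.range (n + 1) := Finset.mem_range.2 r.2
  refine ⟨n, fun r => Q r, fun r => ?_, fun r s hrs => ?_, ?_, fun t ht => ?_⟩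
  · exact (horth r (hmem r) r (hmem r)).trans (if_pos rfl)
  · have := horth r (hmem r) s (hmem s)
    rwa [if_neg fun h => hrs (Fin.ext h.symm)] at this
  · rw [Fin.sum_univ_eq_sum_range Q, ← hone, hexp 1 zero_le_one]
    simp
  · rw [hexp t ht, Fin.sum_univ_eq_sum_range fun r => t ^ r • Q r]
end
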